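/- Let K be a totally real number field of degree n over ℚ with discriminant Δ_K. Then for every totally positive a ∈ K, μ(a) · μ(a⁻¹) ≤ (4/π²) · Γ(2 + n/2)^{4/n} · |Δ_K|^{2/n}. -/

import Mathlib

open NumberField Real

/-- An element of a number field is *totally positive* if it is positive under
every real embedding. -/
def TotPos {K : Type*} [Field K] (a : K) : Prop := ∀ φ : K →+* ℝ, 0 < φ a

/-- The value of the trace form `Tr_{K/ℚ}(a x²)` at an algebraic integer `x`. -/
noncomputable def trForm {K : Type*} [Field K] [NumberField K] (a : K) (x : 𝓞 K) : ℚ :=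
  Algebra.trace ℚ K (a * (x : K) ^ 2)

/-- `μ(a)`: the minimum of `Tr_{K/ℚ}(a x²)` over nonzero `x ∈ 𝓞 K`. -/
noncomputable def muMin {K : Type*} [Field K] [NumberField K] (a : K) : ℝ :=
  sInf {t : ℝ | ∃ x : 𝓞 K, x ≠ 0 ∧ (trForm a x : ℝ) = t}

/-- `M(a)`: the set of algebraic integers attaining `μ(a)`. -/
def MinVecs {K : Type*} [Field K] [NumberField K] (a : K) : Set (𝓞 K) :=
  {x | ((trForm a x : ℚ) : ℝ) = muMin a}

/-- A totally positive `a` is *perfect* if it is the unique totally positive element `b`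
with `Tr(b x²) = μ(a)` for all `x ∈ M(a)`. -/
def IsPerfectForm {K : Type*} [Field K] [NumberField K] (a : K) : Prop :=
  TotPos a ∧ ∀ b : K, TotPos b → (∀ x ∈ MinVecs a, ((trForm b x : ℚ) : ℝ) = muMin a) → b = a

/-- `a ~ a'` : equivalence by squares of units. -/
def UnitEquiv {K : Type*} [Field K] [NumberField K] (a a' : K) : Prop :=
  ∃ u : (𝓞 K)ˣ, a' = a * ((u : 𝓞 K) : K) ^ 2

/-- Homothety: `a` and `b` are homothetic if `λ a ~ b` for some positive rational `λ`. -/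
def Homothetic {K : Type*} [Field K] [NumberField K] (a b : K) : Prop :=
  ∃ q : ℚ, 0 < q ∧ UnitEquiv ((q : K) * a) b

/-- The number of homothety classes of perfect unary forms of `K`. -/
noncomputable def numClasses (K : Type*) [Field K] [NumberField K] : ℕ :=
  Nat.card (Quot (fun a b : {a : K // IsPerfectForm a} => Homothetic (a : K) (b : K)))

/-- `K` is `A`-reducible if minimal vectors of totally positive elements have norm at most `A`. -/
def IsAReducible (K : Type*) [Field K] [NumberField K] (A : ℝ) : Prop :=
  ∀ a : K, TotPos a → ∀ x ∈ MinVecs a, |(Algebra.norm ℚ (x : K) : ℝ)| ≤ A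

/-- `K` is totally real if every infinite place is real. -/
def TotallyReal (K : Type*) [Field K] [NumberField K] : Prop :=
  ∀ v : NumberField.InfinitePlace K, v.IsReal


/-- Blichfeldt's inequality: the truncated parabolic densities centred at points whose mutual
squared distances are at least `m` add up to at most `1` at the origin. -/
theorem sum_max_one_sub_norm_sq_le_one {E α : Type*} [NormedAddCommGroup E]
    [InnerProductSpace ℝ E] (s : Finset α) (x : α → E) {m : ℝ} (hm : 0 < m)
    (hx : ∀ i ∈ s, ∀ j ∈ s, i ≠ j → m ≤ ‖x i - x j‖ ^ 2) :
    ∑ i ∈ s, max 0 (1 - 2 * ‖x i‖ ^ 2 / m) ≤ 1 := by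
  classical
  set t := s.filter fun i => 0 < 1 - 2 * ‖x i‖ ^ 2 / m with ht
  have hsum : ∑ i ∈ s, max 0 (1 - 2 * ‖x i‖ ^ 2 / m) = ∑ i ∈ t, (1 - 2 * ‖x i‖ ^ 2 / m) := by
    rw [ht, Finset.sum_filter]
    refine Finset.sum_congr rfl fun i _ => ?_
    split_ifs with h
    · exact max_eq_right h.le
    · exact max_eq_left (not_lt.mp h)
  rw [hsum]
  rcases t.eq_empty_or_nonempty with h | h
  · simp [h]
  have hk : (0 : ℝ) < t.card := by exact_mod_cast h.card_pos
  have upper : ∑ i ∈ t, ∑ j ∈ t, ‖x i - x j‖ ^ 2 ≤ 2 * t.card * ∑ i ∈ t, ‖x i‖ ^ 2 := by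
    have h1 : ∑ i ∈ t, ∑ j ∈ t, inner ℝ (x i) (x j) = ‖∑ i ∈ t, x i‖ ^ 2 := by
      rw [← real_inner_self_eq_norm_sq, sum_inner]
      simp_rw [inner_sum]
    simp_rw [norm_sub_sq_real, Finset.sum_add_distrib, Finset.sum_sub_distrib, ← Finset.mul_sum,
      h1, Finset.sum_const, nsmul_eq_mul, ← Finset.mul_sum]
    nlinarith [sq_nonneg ‖∑ i ∈ t, x i‖]
  have lower : (t.card : ℝ) * ((t.card - 1) * m) ≤ ∑ i ∈ t, ∑ j ∈ t, ‖x i - x j‖ ^ 2 := by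
    rw [← nsmul_eq_mul]
    refine Finset.card_nsmul_le_sum _ _ _ fun i hi => ?_
    rw [← Finset.sum_erase t (a := i) (by simp)]
    have : ((t.card : ℝ) - 1) * m = (t.erase i).card • m := by
      rw [Finset.card_erase_of_mem hi, nsmul_eq_mul, Nat.cast_pred h.card_pos]
    rw [this]
    refine Finset.card_nsmul_le_sum _ _ _ fun j hj => ?_
    rw [Finset.mem_erase] at hj
    exact hx i (Finset.mem_filter.mp hi).1 j (Finset.mem_filter.mp hj.2).1 hj.1.symm
  have key : ((t.card : ℝ) - 1) * m ≤ 2 * ∑ i ∈ t, ‖x i‖ ^ 2 := by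
    refine le_of_mul_le_mul_left ?_ hk
    linarith
  rw [Finset.sum_sub_distrib, ← Finset.sum_div, ← Finset.mul_sum, Finset.sum_const,
    nsmul_eq_mul, mul_one]
  have := (le_div_iff₀ hm).mpr key
  linarith

open MeasureTheory in
/-- The integral of the truncated parabolic density over Euclidean space. -/
theorem lintegral_one_sub_norm_sq (ι : Type*) [Fintype ι] [Nonempty ι] {m : ℝ} (hm : 0 < m) :
    ∫⁻ x : EuclideanSpace ℝ ι, ENNReal.ofReal (max 0 (1 - 2 * ‖x‖ ^ 2 / m)) =
      ENNReal.ofReal (√(m * π / 2) ^ Fintype.card ι / Gamma (2 + Fintype.card ι / 2)) := by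
  set n := Fintype.card ι with hn
  have hn0 : 0 < n := Fintype.card_pos
  set r := √(m / 2) with hr
  have hr0 : 0 < r := Real.sqrt_pos.mpr (by positivity)
  have hr2 : r ^ 2 = m / 2 := Real.sq_sqrt (by positivity)
  have hvanish : ∀ y : ℝ, r < y → max 0 (1 - 2 * y ^ 2 / m) = 0 := fun y hy => by
    refine max_eq_left ?_
    rw [sub_nonpos, one_le_div hm]
    nlinarith
  have hpos : ∀ y ∈ Set.Icc 0 r, max 0 (1 - 2 * y ^ 2 / m) = 1 - 2 * y ^ 2 / m := fun y hy => by
    refine max_eq_right ?_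
    rw [sub_nonneg, div_le_one hm]
    nlinarith [hy.1, hy.2]
  have hcont : Continuous fun x : EuclideanSpace ℝ ι => max 0 (1 - 2 * ‖x‖ ^ 2 / m) := by
    fun_prop
  have hint : Integrable fun x : EuclideanSpace ℝ ι => max 0 (1 - 2 * ‖x‖ ^ 2 / m) := by
    refine hcont.integrable_of_hasCompactSupport ?_
    refine HasCompactSupport.intro (isCompact_closedBall 0 r) fun x hx => hvanish _ ?_
    simpa using hx
  rw [← ofReal_integral_eq_lintegral_ofReal hint (.of_forall fun _ => le_max_left _ _)]
  congr 1
  rw [integral_fun_norm_addHaar volume fun y => max 0 (1 - 2 * y ^ 2 / m)]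
  have hradial : ∫ y in Set.Ioi (0 : ℝ), y ^ (n - 1) • max 0 (1 - 2 * y ^ 2 / m) =
      2 * r ^ n / (n * (n + 2)) := by
    have h1 : ∫ y in Set.Ioi (0 : ℝ), y ^ (n - 1) • max 0 (1 - 2 * y ^ 2 / m) =
        ∫ y in Set.Ioc 0 r, y ^ (n - 1) • max 0 (1 - 2 * y ^ 2 / m) := by
      refine (setIntegral_eq_of_subset_of_forall_sdiff_eq_zero measurableSet_Ioi
        Set.Ioc_subset_Ioi_self fun y hy => ?_)
      have : r < y := by
        by_contra h
        exact hy.2 ⟨hy.1, not_lt.mp h⟩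
      rw [hvanish y this, smul_zero]
    rw [h1, ← intervalIntegral.integral_of_le hr0.le]
    have h2 : ∫ y in (0 : ℝ)..r, y ^ (n - 1) • max 0 (1 - 2 * y ^ 2 / m) =
        ∫ y in (0 : ℝ)..r, (y ^ (n - 1) - 2 / m * y ^ (n + 1)) := by
      refine intervalIntegral.integral_congr fun y hy => ?_
      rw [Set.uIcc_of_le hr0.le] at hy
      simp only [smul_eq_mul]
      rw [hpos y hy]
      obtain ⟨k, hk⟩ : ∃ k, n = k + 1 := ⟨n - 1, by omega⟩
      rw [hk, Nat.add_sub_cancel]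
      ring
    rw [h2, intervalIntegral.integral_sub 
      (Continuous.intervalIntegrable (by fun_prop) _ _)
      (Continuous.intervalIntegrable (by fun_prop) _ _),
      intervalIntegral.integral_const_mul, integral_pow, integral_pow]
    have hm2 : m = 2 * r ^ 2 := by linarith
    obtain ⟨k, hk⟩ : ∃ k, n = k + 1 := ⟨n - 1, by omega⟩
    rw [hm2, hk]
    rw [Nat.add_sub_cancel]
    push_cast
    field_simp
    ring
  rw [finrank_euclideanSpace, ← hn, hradial, measureReal_def, EuclideanSpace.volume_ball]
  have hG : 0 < Gamma ((n : ℝ) / 2 + 1) := Gamma_pos_of_pos (by positivity)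
  have hG2 : Gamma (2 + (n : ℝ) / 2) = ((n : ℝ) / 2 + 1) * Gamma ((n : ℝ) / 2 + 1) := by
    rw [← Gamma_add_one (by positivity)]
    ring_nf
  have hsq : √(m * π / 2) = r * √π := by
    rw [hr, ← Real.sqrt_mul (by positivity)]
    ring_nf
  rw [hG2, hsq, ENNReal.ofReal_one, one_pow, one_mul, ENNReal.toReal_ofReal (by positivity),
    ← hn, nsmul_eq_mul, smul_eq_mul, mul_pow]
  field_simp

open MeasureTheory NumberField.InfinitePlace NumberField.mixedEmbedding

open scoped Classical in
/-- In a totally real field, the trace is the sum over the real places. -/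
theorem trace_eq_sum_real_places {K : Type*} [Field K] [NumberField K] (htr : TotallyReal K)
    (x : K) : ((Algebra.trace ℚ K x : ℚ) : ℝ) =
      ∑ w : {w : InfinitePlace K // w.IsReal}, embedding_of_isReal w.2 x := by
  have h := trace_eq_sum_embeddings (K := ℚ) (L := K) ℂ (x := x)
  have h2 : ∑ w : {w : InfinitePlace K // w.IsReal}, (embedding_of_isReal w.2 x : ℂ) =
      ∑ σ : K →ₐ[ℚ] ℂ, σ x := by
    refine Fintype.sum_bijective (fun w => w.1.embedding.toRatAlgHom) ⟨?_, fun φ => ?_⟩ _ _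
      fun w => embedding_of_isReal_apply w.2 x
    · intro w w' h
      apply Subtype.ext
      rw [← mk_embedding w.1, ← mk_embedding w'.1]
      congr 1
      ext y
      exact DFunLike.congr_fun h y
    · refine ⟨⟨InfinitePlace.mk φ, htr _⟩, ?_⟩
      ext y
      simp [embedding_mk_eq_of_isReal (isReal_of_mk_isReal (htr (InfinitePlace.mk (φ : K →+* ℂ))))]
  rw [← h2] at h
  apply Complex.ofReal_injective
  push_cast
  simpa using h

open scoped Classical in
/-- In a totally real field, the trace form is a weighted sum of squares. -/
theorem trForm_eq_sum {K : Type*} [Field K] [NumberField K] (htr : TotallyReal K) (a : K)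
    (x : 𝓞 K) : (trForm a x : ℝ) = ∑ w : {w : InfinitePlace K // w.IsReal},
      embedding_of_isReal w.2 a * embedding_of_isReal w.2 (x : K) ^ 2 := by
  simp [trForm, trace_eq_sum_real_places htr]

theorem trForm_nonneg {K : Type*} [Field K] [NumberField K] (htr : TotallyReal K) {a : K}
    (ha : TotPos a) (x : 𝓞 K) : (0 : ℝ) ≤ trForm a x := by
  rw [trForm_eq_sum htr]
  exact Finset.sum_nonneg fun w _ => mul_nonneg (ha _).le (sq_nonneg _)

theorem muMin_le_trForm {K : Type*} [Field K] [NumberField K] (htr : TotallyReal K) {a : K}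
    (ha : TotPos a) {x : 𝓞 K} (hx : x ≠ 0) : muMin a ≤ trForm a x :=
  csInf_le ⟨0, by rintro _ ⟨y, -, rfl⟩; exact trForm_nonneg htr ha y⟩ ⟨x, hx, rfl⟩

theorem muMin_nonneg {K : Type*} [Field K] [NumberField K] (htr : TotallyReal K) {a : K}
    (ha : TotPos a) : 0 ≤ muMin a :=
  Real.sInf_nonneg (by rintro _ ⟨y, -, rfl⟩; exact trForm_nonneg htr ha y)

/-- Pushing forward Lebesgue measure on `ι → ℝ` along a diagonal map to Euclidean space. -/
theorem lintegral_comp_diagonal {ι : Type*} [Fintype ι] {d : ι → ℝ} (hd : ∀ i, 0 < d i)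
    {g : EuclideanSpace ℝ ι → ENNReal} (hg : Measurable g) :
    ∫⁻ x, g x = ENNReal.ofReal (∏ i, d i) *
      ∫⁻ x : ι → ℝ, g (WithLp.toLp 2 fun i => d i * x i) := by
  classical
  have hdet : (Matrix.diagonal d).det = ∏ i, d i := Matrix.det_diagonal
  have hpos : 0 < ∏ i, d i := Finset.prod_pos fun i _ => hd i
  have hmeas : Measurable (Matrix.toLin' (Matrix.diagonal d)) :=
    (LinearMap.continuous_of_finiteDimensional _).measurable
  have hlp := (PiLp.volume_preserving_toLp ι)
  rw [← hlp.lintegral_comp hg]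
  conv_lhs => rw [← Real.smul_map_diagonal_volume_pi (D := d) (by rw [hdet]; exact hpos.ne')]
  rw [lintegral_smul_measure, smul_eq_mul, hdet, abs_of_pos hpos,
    lintegral_map (f := fun x => g (WithLp.toLp 2 x)) (hg.comp hlp.measurable) hmeas]
  congr 2 with x
  congr 2 with i
  simp [Matrix.toLin'_apply, Matrix.mulVec_diagonal]

open scoped Classical in
/-- The mixed space of a totally real field is a product of copies of `ℝ`. -/
theorem lintegral_mixedSpace {K : Type*} [Field K] [NumberField K] (htr : TotallyReal K)
    {g : ({w : InfinitePlace K // w.IsReal} → ℝ) → ENNReal} (hg : Measurable g) :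
    ∫⁻ x : mixedSpace K, g x.1 = ∫⁻ x, g x := by
  have : IsEmpty {w : InfinitePlace K // w.IsComplex} :=
    ⟨fun w => not_isReal_iff_isComplex.mpr w.2 (htr w.1)⟩
  have : IsProbabilityMeasure
      (volume : Measure ({w : InfinitePlace K // w.IsComplex} → ℂ)) := by
    rw [Measure.volume_pi_eq_dirac 0]
    infer_instance
  exact (measurePreserving_fst (μ := volume) (ν := volume)).lintegral_comp hg

open scoped Classical in
/-- Blichfeldt's bound for the trace form of a totally positive element. -/
theorem sqrt_pow_div_gamma_le {K : Type*} [Field K] [NumberField K] (htr : TotallyReal K) {a : K}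
    (ha : TotPos a) {m : ℝ} (hm : 0 < m) (hmin : ∀ x : 𝓞 K, x ≠ 0 → m ≤ trForm a x) :
    √(m * π / 2) ^ Module.finrank ℚ K / Gamma (2 + Module.finrank ℚ K / 2) ≤
      √(∏ w : {w : InfinitePlace K // w.IsReal}, embedding_of_isReal w.2 a) *
        √|(NumberField.discr K : ℝ)| := by
  have hc : nrComplexPlaces K = 0 :=
    Fintype.card_eq_zero_iff.mpr ⟨fun w => not_isReal_iff_isComplex.mpr w.2 (htr w.1)⟩
  have hcard : Fintype.card {w : InfinitePlace K // w.IsReal} = Module.finrank ℚ K := by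
    rw [← card_add_two_mul_card_eq_rank, hc, mul_zero, add_zero]
  have : Nonempty {w : InfinitePlace K // w.IsReal} :=
    ⟨⟨Classical.arbitrary _, htr _⟩⟩
  set d : {w : InfinitePlace K // w.IsReal} → ℝ := fun w => √(embedding_of_isReal w.2 a) with hd
  have hd0 : ∀ w, 0 < d w := fun w => Real.sqrt_pos.mpr (ha _)
  let T : mixedSpace K → EuclideanSpace ℝ {w : InfinitePlace K // w.IsReal} :=
    fun x => WithLp.toLp 2 fun w => d w * x.1 w
  have hTsub : ∀ x y, T x - T y = T (x - y) := fun x y => by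
    ext w
    simp [T, mul_sub]
  have hTnorm : ∀ x : 𝓞 K, ‖T (mixedEmbedding K (x : K))‖ ^ 2 = trForm a x := fun x => by
    rw [trForm_eq_sum htr, EuclideanSpace.norm_sq_eq]
    refine Finset.sum_congr rfl fun w _ => ?_
    simp only [T, hd, Real.norm_eq_abs, sq_abs, mul_pow, Real.sq_sqrt (ha _).le]
    congr 2
  let g : EuclideanSpace ℝ {w : InfinitePlace K // w.IsReal} → ENNReal :=
    fun x => ENNReal.ofReal (max 0 (1 - 2 * ‖x‖ ^ 2 / m))
  have hg : Measurable g := by fun_prop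
  have hT : Measurable T := by fun_prop
  have hfund := ZSpan.isAddFundamentalDomain' (latticeBasis K) volume
  have : Countable (Submodule.span ℤ (Set.range (latticeBasis K))).toAddSubgroup := by
    change Countable (Submodule.span ℤ (Set.range (latticeBasis K)))
    infer_instance
  have hpack : ∫⁻ x : mixedSpace K, g (T x) ≤
      volume (ZSpan.fundamentalDomain (latticeBasis K)) := by
    have hmeas : ∀ l : (Submodule.span ℤ (Set.range (latticeBasis K))).toAddSubgroup,
        Measurable fun x : mixedSpace K => g (T (l +ᵥ x)) :=
      fun l => (hg.comp hT).comp (measurable_const_vadd l)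
    rw [hfund.lintegral_eq_tsum'', ← lintegral_tsum fun l => (hmeas l).aemeasurable,
      ← setLIntegral_one]
    refine lintegral_mono fun x => ?_
    rw [ENNReal.tsum_eq_iSup_sum]
    refine iSup_le fun s => ?_
    rw [← ENNReal.ofReal_sum_of_nonneg fun _ _ => le_max_left _ _, ← ENNReal.ofReal_one]
    refine ENNReal.ofReal_le_ofReal (sum_max_one_sub_norm_sq_le_one s _ hm ?_)
    intro i _ j _ hij
    obtain ⟨y, hy⟩ := (mem_span_latticeBasis K).mp (i - j).2
    have hTy : T (i +ᵥ x) - T (j +ᵥ x) = T (mixedEmbedding K (y : K)) := by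
      rw [hTsub]
      congr 1
      have : mixedEmbedding K (y : K) = (i : mixedSpace K) - j := hy
      rw [this]
      exact add_sub_add_right_eq_sub _ _ _
    rw [hTy, hTnorm]
    refine hmin y fun h0 => hij ?_
    rw [h0] at hy
    exact sub_eq_zero.mp (Subtype.ext (by simpa using hy.symm))
  have hint := lintegral_comp_diagonal hd0 hg
  rw [← lintegral_mixedSpace htr (g := fun x => g (WithLp.toLp 2 fun w => d w * x w))
    (by fun_prop), lintegral_one_sub_norm_sq _ hm, hcard] at hint
  have hprod : ∏ w, d w =
      √(∏ w : {w : InfinitePlace K // w.IsReal}, embedding_of_isReal w.2 a) :=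
    (Real.sqrt_prod _ fun w _ => (ha _).le).symm
  have hvol : volume (ZSpan.fundamentalDomain (latticeBasis K)) =
      ENNReal.ofReal √|(NumberField.discr K : ℝ)| := by
    rw [volume_fundamentalDomain_latticeBasis, hc, pow_zero, one_mul, ← ENNReal.ofReal_coe_nnreal]
    congr 1
    simp [Int.norm_eq_abs]
  rw [← ENNReal.ofReal_le_ofReal_iff (by positivity), ENNReal.ofReal_mul (by positivity), hint,
    ← hprod, ← hvol]
  exact mul_le_mul_right hpack _

/-- For every totally positive a, the product of the minima of a and
of its inverse is bounded in terms of the discriminant. -/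
theorem mu_mul_mu_inv_bound
    (K : Type*) [Field K] [NumberField K] (n : ℕ)
    (hdeg : Module.finrank ℚ K = n) (htr : TotallyReal K)
    (a : K) (ha : TotPos a) :
    muMin a * muMin a⁻¹ ≤
      4 / π ^ 2 * Real.Gamma (2 + (n : ℝ) / 2) ^ ((4 : ℝ) / (n : ℝ)) *
        |(NumberField.discr K : ℝ)| ^ ((2 : ℝ) / (n : ℝ)) := by
  classical
  have hn : 0 < n := hdeg ▸ Module.finrank_pos
  have hG : 0 < Gamma (2 + (n : ℝ) / 2) := Gamma_pos_of_pos (by positivity)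
  have ha' : TotPos a⁻¹ := fun φ => by
    rw [map_inv₀]
    exact inv_pos.mpr (ha φ)
  rcases (muMin_nonneg htr ha).eq_or_lt with h0 | h0
  · rw [← h0, zero_mul]
    positivity
  rcases (muMin_nonneg htr ha').eq_or_lt with h0' | h0'
  · rw [← h0', mul_zero]
    positivity
  have h1 := sqrt_pow_div_gamma_le htr ha h0 fun x hx => muMin_le_trForm htr ha hx
  have h2 := sqrt_pow_div_gamma_le htr ha' h0' fun x hx => muMin_le_trForm htr ha' hx
  rw [hdeg] at h1 h2
  set p := muMin a
  set q := muMin a⁻¹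
  set G := Gamma (2 + (n : ℝ) / 2)
  set D := |(NumberField.discr K : ℝ)|
  set N := ∏ w : {w : InfinitePlace K // w.IsReal}, embedding_of_isReal w.2 a with hN
  have hNpos : 0 < N := Finset.prod_pos fun w _ => ha _
  have hNinv : ∏ w : {w : InfinitePlace K // w.IsReal}, embedding_of_isReal w.2 a⁻¹ = N⁻¹ := by
    simp_rw [map_inv₀, Finset.prod_inv_distrib, hN]
  rw [hNinv] at h2
  have hD : 0 ≤ D := abs_nonneg _
  have h3 : √(p * π / 2 * (q * π / 2)) ^ n ≤ G ^ 2 * D := by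
    have h := mul_le_mul h1 h2 (by positivity) (by positivity)
    have hr : √N * √D * (√N⁻¹ * √D) = D := by
      rw [Real.sqrt_inv]
      have := Real.mul_self_sqrt hD
      have := (Real.sqrt_pos.mpr hNpos).ne'
      field_simp
      linarith
    rw [hr, div_mul_div_comm, div_le_iff₀ (by positivity), ← mul_pow,
      ← Real.sqrt_mul (by positivity)] at h
    linarith
  have h4 : p * π / 2 * (q * π / 2) ≤ (G ^ 2 * D) ^ ((2 : ℝ) / n) := by
    have h := Real.rpow_le_rpow (by positivity) h3 (z := (2 : ℝ) / n) (by positivity)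
    rwa [← Real.rpow_natCast, ← Real.rpow_mul (by positivity), mul_div_cancel₀ _ (by positivity),
      Real.rpow_two, Real.sq_sqrt (by positivity)] at h
  rw [Real.mul_rpow (by positivity) hD, ← Real.rpow_natCast, ← Real.rpow_mul hG.le,
    show ((2 : ℕ) : ℝ) * (2 / n) = 4 / n by push_cast; ring] at h4
  calc p * q = 4 / π ^ 2 * (p * π / 2 * (q * π / 2)) := by
        field_simp
        ring
    _ ≤ 4 / π ^ 2 * (G ^ ((4 : ℝ) / n) * D ^ ((2 : ℝ) / n)) := by gcongr
    _ = _ := by ring
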